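/- arXiv:1710.01774 — 2 statements merged into one kernel-verified Lean document; each statement's English description precedes it below -/
import Mathlib

section
/- Suppose F is a countable field and A is a completely integrally closed local subring of F that is not a valuation ring of F. If X ⊆ Zar(F) satisfies A = ⋂_{V∈X} V and J(X) = ⋂_{V∈X} 𝔪_V ≠ 0, then lim X contains a patch-closed subset Y with ⋂_{V∈Y} V = A that is homeomorphic, in the patch topology, to the Cantor set. -/
open Set

/-- A subring `V` of a field `F` is a valuation ring of `F` (with quotient field `F`). -/
def IsValSubring (F : Type*) [Field F] (V : Subring F) : Prop :=
  ∀ t : F, t ≠ 0 → t ∈ V ∨ t⁻¹ ∈ V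

/-- The Zariski-Riemann space of the field `F`: the set of valuation rings of `F`. -/
def Zar (F : Type*) [Field F] : Type _ := {V : Subring F // IsValSubring F V}

/-- The patch (constructible) topology on `Zar F`, generated by the sets
`{V : x ∈ V}` and `{V : y ∉ V}` for `x, y ∈ F`. -/
instance Zar.patchTopology (F : Type*) [Field F] : TopologicalSpace (Zar F) :=
  TopologicalSpace.generateFrom
    ({S | ∃ x : F, S = {V : Zar F | x ∈ V.1}} ∪ {S | ∃ y : F, S = {V : Zar F | y ∉ V.1}})

variable {F : Type*} [Field F]

/-- The maximal ideal of a valuation ring of `F`, as a subset of `F`. -/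
def mIdeal (V : Zar F) : Set F := {x : F | x ∈ V.1 ∧ (x = 0 ∨ x⁻¹ ∉ V.1)}

/-- `A(X)`: the intersection of the valuation rings in `X`, as a subset of `F`. -/
def aSet (X : Set (Zar F)) : Set F := ⋂ V ∈ X, ((V : Zar F).1 : Set F)

/-- `A(X)` as a subring of `F`. -/
def ASub (X : Set (Zar F)) : Subring F := ⨅ V ∈ X, (V : Zar F).1

/-- `J(X)`: the intersection of the maximal ideals of the valuation rings in `X`. -/
def jSet (X : Set (Zar F)) : Set F := ⋂ V ∈ X, mIdeal V

/-- The set of limit points of `X` in the patch topology of `Zar F`. -/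
def limPts (X : Set (Zar F)) : Set (Zar F) :=
  {V : Zar F | ∀ U : Set (Zar F), IsOpen U → V ∈ U → ∃ W ∈ X, W ≠ V ∧ W ∈ U}


/-- A subring `A` of `F` is completely integrally closed: every element of `F`
almost integral over `A` belongs to `A`. -/
def IsCIC (A : Subring F) : Prop :=
  ∀ t : F, (∃ a : F, a ∈ A ∧ a ≠ 0 ∧ ∀ n : ℕ, 0 < n → a * t ^ n ∈ A) → t ∈ A

open Filter Topology

namespace Stmt12Aux

section Brouwer

variable {Y : Type*} [TopologicalSpace Y]

/-- `n` splits `C`. -/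
def Splits (K : ℕ → Set Y) (C : Set Y) (n : ℕ) : Prop :=
  (∃ z ∈ C, z ∈ K n) ∧ (∃ z ∈ C, z ∉ K n)

noncomputable def sp (K : ℕ → Set Y) (C : Set Y) : ℕ := sInf {n | Splits K C n}

def Cs (K : ℕ → Set Y) : List Bool → Set Y
  | [] => Set.univ
  | b :: l => {z | z ∈ Cs K l ∧ (z ∈ K (sp K (Cs K l)) ↔ b = true)}

open Classical in
noncomputable def Ls (K : ℕ → Set Y) : ℕ → Y → List Bool
  | 0, _ => []
  | k + 1, y => decide (y ∈ K (sp K (Cs K (Ls K k y)))) :: Ls K k y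

open Classical in
noncomputable def fm (K : ℕ → Set Y) (y : Y) (k : ℕ) : Bool :=
  decide (y ∈ K (sp K (Cs K (Ls K k y))))

theorem brouwer [CompactSpace Y] [Nonempty Y] (K : ℕ → Set Y) (hK : ∀ n, IsClopen (K n))
    (hsep : ∀ y z : Y, y ≠ z → ∃ n, ¬ (y ∈ K n ↔ z ∈ K n))
    (hperf : ∀ U : Set Y, IsOpen U → ∀ x ∈ U, ∃ y ∈ U, y ≠ x) :
    Nonempty (Y ≃ₜ (ℕ → Bool)) := by
  classical
  have hCl : ∀ l, IsClopen (Cs K l) := by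
    intro l
    induction l with
    | nil => exact isClopen_univ
    | cons b l ih =>
      cases b with
      | true =>
        have : Cs K (true :: l) = Cs K l ∩ K (sp K (Cs K l)) := by
          ext z; simp [Cs]
        rw [this]; exact ih.inter (hK _)
      | false =>
        have : Cs K (false :: l) = Cs K l ∩ (K (sp K (Cs K l)))ᶜ := by
          ext z; simp [Cs]
        rw [this]; exact ih.inter (hK _).compl
  have hspl : ∀ l, (Cs K l).Nonempty → Splits K (Cs K l) (sp K (Cs K l)) := by
    intro l ⟨x, hx⟩
    obtain ⟨y, hy, hyx⟩ := hperf _ (hCl l).isOpen x hx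
    obtain ⟨n, hn⟩ := hsep _ _ hyx
    have : {n | Splits K (Cs K l) n}.Nonempty := by
      refine ⟨n, ?_⟩
      by_cases h : y ∈ K n
      · exact ⟨⟨y, hy, h⟩, ⟨x, hx, fun h' => hn (by simp [h, h'])⟩⟩
      · exact ⟨⟨x, hx, by tauto⟩, ⟨y, hy, h⟩⟩
    exact Nat.sInf_mem this
  have hne : ∀ l, (Cs K l).Nonempty := by
    intro l
    induction l with
    | nil => exact Set.univ_nonempty
    | cons b l ih =>
      obtain ⟨⟨z, hz, hz'⟩, ⟨w, hw, hw'⟩⟩ := hspl l ih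
      cases b with
      | true => exact ⟨z, hz, by simp [hz']⟩
      | false => exact ⟨w, hw, by simp [hw']⟩
  have hLC : ∀ k y, y ∈ Cs K (Ls K k y) := by
    intro k y
    induction k with
    | zero => exact Set.mem_univ _
    | succ k ih => exact ⟨ih, by simp⟩
  have hLcont : ∀ k y, ∀ᶠ z in 𝓝 y, Ls K k z = Ls K k y := by
    intro k y
    induction k with
    | zero => exact Filter.Eventually.of_forall fun _ => rfl
    | succ k ih =>
      have h2 : ∀ᶠ z in 𝓝 y, (z ∈ K (sp K (Cs K (Ls K k y))) ↔ y ∈ K (sp K (Cs K (Ls K k y)))) := by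
        by_cases h : y ∈ K (sp K (Cs K (Ls K k y)))
        · filter_upwards [(hK _).isOpen.mem_nhds h] with z hz
          simp [h, hz]
        · filter_upwards [(hK _).compl.isOpen.mem_nhds h] with z hz
          have hz' : z ∉ K (sp K (Cs K (Ls K k y))) := hz
          simp [h, hz']
      filter_upwards [ih, h2] with z h1 h2
      simp only [Ls, h1, h2]
  have hLf : ∀ k y, Ls K (k+1) y = fm K y k :: Ls K k y := fun _ _ => rfl
  have hcont : Continuous (fm K) := by
    refine continuous_pi fun k => ?_
    rw [continuous_iff_continuousAt]
    intro y
    have : (fun z => fm K z k) =ᶠ[𝓝 y] fun _ => fm K y k := by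
      filter_upwards [hLcont (k+1) y] with z hz
      rw [hLf, hLf] at hz
      exact (List.cons.inj hz).1
    exact (continuousAt_const (y := fm K y k)).congr this.symm
  have hmono : ∀ b l, sp K (Cs K l) < sp K (Cs K (b :: l)) := by
    intro b l
    obtain ⟨⟨z, hz, hz'⟩, ⟨w, hw, hw'⟩⟩ := hspl _ (hne (b :: l))
    refine lt_of_le_of_ne (Nat.sInf_le ⟨⟨z, hz.1, hz'⟩, ⟨w, hw.1, hw'⟩⟩) ?_
    intro h
    rw [← h] at hz' hw'
    exact hw' (hw.2.2 (hz.2.1 hz'))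
  have hinj : Function.Injective (fm K) := by
    intro y z hyz
    have hL : ∀ k, Ls K k y = Ls K k z := by
      intro k
      induction k with
      | zero => rfl
      | succ k ih => rw [hLf, hLf, ih, hyz]
    have hge : ∀ k, k ≤ sp K (Cs K (Ls K k y)) := by
      intro k
      induction k with
      | zero => exact Nat.zero_le _
      | succ k ih => exact lt_of_le_of_lt ih (by rw [hLf]; exact hmono _ _)
    by_contra hne'
    obtain ⟨m, hm⟩ := hsep _ _ hne'
    have hy := hLC m y
    have hz := hLC m z
    rw [← hL] at hz
    have hle : sp K (Cs K (Ls K m y)) ≤ m := by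
      apply Nat.sInf_le
      by_cases h : y ∈ K m
      · exact ⟨⟨y, hy, h⟩, ⟨z, hz, fun h' => hm (by simp [h, h'])⟩⟩
      · exact ⟨⟨z, hz, by tauto⟩, ⟨y, hy, h⟩⟩
    have heq := le_antisymm hle (hge m)
    have := congrFun hyz m
    unfold fm at this
    rw [← hL, heq] at this
    exact hm (by simpa using this)
  have hsurj : Function.Surjective (fm K) := by
    intro b
    have hint : (⋂ k, Cs K (PiNat.res b k)).Nonempty := by
      apply IsCompact.nonempty_iInter_of_sequence_nonempty_isCompact_isClosed
      · intro k z hz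
        rw [PiNat.res_succ] at hz
        exact hz.1
      · exact fun _ => hne _
      · exact (hCl _).isClosed.isCompact
      · exact fun _ => (hCl _).isClosed
    obtain ⟨y, hy⟩ := hint
    rw [Set.mem_iInter] at hy
    have hd : ∀ k, Ls K k y = PiNat.res b k → fm K y k = b k := by
      intro k hk
      have := hy (k+1)
      rw [PiNat.res_succ] at this
      have h2 := this.2
      unfold fm
      rw [hk]
      rw [Bool.eq_iff_iff]
      simpa using h2
    have hL : ∀ k, Ls K k y = PiNat.res b k := by
      intro k
      induction k with
      | zero => rfl
      | succ k ih => rw [hLf, PiNat.res_succ, hd k ih, ih]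
    exact ⟨y, funext fun k => hd k (hL k)⟩
  exact ⟨Continuous.homeoOfEquivCompactToT2 (f := Equiv.ofBijective _ ⟨hinj, hsurj⟩) hcont⟩

end Brouwer

section ZarTop

variable {F : Type*} [Field F]

theorem isOpen_mem (x : F) : IsOpen {V : Zar F | x ∈ V.1} :=
  TopologicalSpace.isOpen_generateFrom_of_mem (Or.inl ⟨x, rfl⟩)

theorem isOpen_notMem (x : F) : IsOpen {V : Zar F | x ∉ V.1} :=
  TopologicalSpace.isOpen_generateFrom_of_mem (Or.inr ⟨x, rfl⟩)

theorem isClopen_mem (x : F) : IsClopen {V : Zar F | x ∈ V.1} :=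
  ⟨⟨isOpen_notMem x⟩, isOpen_mem x⟩

theorem isClopen_notMem (x : F) : IsClopen {V : Zar F | x ∉ V.1} := (isClopen_mem x).compl

/-- The ultrafilter limit of valuation rings. -/
def ulim (u : Ultrafilter (Zar F)) : Zar F :=
  ⟨{ carrier := {x | ∀ᶠ W in (u : Filter (Zar F)), x ∈ W.1}
     mul_mem' := fun {a b} ha hb => by
      filter_upwards [ha, hb] with W h1 h2 using W.1.mul_mem h1 h2
     one_mem' := Filter.Eventually.of_forall fun W => W.1.one_mem
     add_mem' := fun {a b} ha hb => by
      filter_upwards [ha, hb] with W h1 h2 using W.1.add_mem h1 h2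
     zero_mem' := Filter.Eventually.of_forall fun W => W.1.zero_mem
     neg_mem' := fun {a} ha => by
      filter_upwards [ha] with W h1 using W.1.neg_mem h1 }, by
    intro t ht
    have : ∀ᶠ W in (u : Filter (Zar F)), t ∈ W.1 ∨ t⁻¹ ∈ W.1 :=
      Filter.Eventually.of_forall fun W => W.2 t ht
    exact Ultrafilter.eventually_or.1 this⟩

theorem mem_ulim (u : Ultrafilter (Zar F)) (x : F) :
    x ∈ (ulim u).1 ↔ ∀ᶠ W in (u : Filter (Zar F)), x ∈ W.1 := Iff.rfl

instance : CompactSpace (Zar F) := by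
  refine ⟨isCompact_iff_ultrafilter_le_nhds.2 fun u _ => ⟨ulim u, Set.mem_univ _, ?_⟩⟩
  rw [TopologicalSpace.nhds_generateFrom]
  refine le_iInf₂ fun S hS => ?_
  rw [Filter.le_principal_iff]
  obtain ⟨hmem, ⟨x, rfl⟩ | ⟨x, rfl⟩⟩ := hS
  · exact (mem_ulim u x).1 hmem
  · exact Ultrafilter.eventually_not.2 hmem

theorem exists_sep {V W : Zar F} (h : V ≠ W) : ∃ x : F, ¬ (x ∈ V.1 ↔ x ∈ W.1) := by
  by_contra! hc
  exact h (Subtype.ext (Subring.ext hc))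

theorem mem_aSet {X : Set (Zar F)} {t : F} : t ∈ aSet X ↔ ∀ V ∈ X, t ∈ V.1 := by
  simp [aSet]

/-- The algebraic key step. -/
theorem key (A : Subring F) (hcic : IsCIC A) (hloc : IsLocalRing A)
    (V : Zar F) (Z : Set (Zar F)) (hZ : Z.Nonempty)
    (hA : ∀ t, t ∈ A ↔ t ∈ V.1 ∧ ∀ W ∈ Z, t ∈ W.1)
    (c : F) (hc0 : c ≠ 0) (hcA : c ∈ A) (hcZ : ∀ W ∈ Z, c⁻¹ ∉ W.1)
    (b : F) (hb : ∀ W ∈ Z, b ∈ W.1) : b ∈ A := by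
  by_contra hbA
  have h1 : ∃ n : ℕ, c * b ^ n ∉ A := by
    by_contra! h
    exact hbA (hcic b ⟨c, hcA, hc0, fun n _ => h n⟩)
  obtain ⟨n, hn⟩ := h1
  have hb0 : b ≠ 0 := fun h => hbA (h ▸ A.zero_mem)
  set d := c * b ^ n with hd
  have hd0 : d ≠ 0 := mul_ne_zero hc0 (pow_ne_zero _ hb0)
  have hdW : ∀ W ∈ Z, d ∈ W.1 := fun W hW =>
    W.1.mul_mem (((hA c).1 hcA).2 W hW) (W.1.pow_mem (hb W hW) n)
  have hdiW : ∀ W ∈ Z, d⁻¹ ∉ W.1 := by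
    intro W hW h
    apply hcZ W hW
    have : c⁻¹ = d⁻¹ * b ^ n := by rw [hd]; field_simp
    rw [this]
    exact W.1.mul_mem h (W.1.pow_mem (hb W hW) n)
  have hdV : d ∉ V.1 := fun h => hn ((hA d).2 ⟨h, hdW⟩)
  have h1d : 1 + d ∉ V.1 := fun h => hdV (by simpa using V.1.sub_mem h V.1.one_mem)
  have h1d0 : 1 + d ≠ 0 := fun h => h1d (h ▸ V.1.zero_mem)
  have he : (1 + d)⁻¹ ∈ A := by
    refine (hA _).2 ⟨(V.2 _ h1d0).resolve_left h1d, fun W hW => ?_⟩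
    have hg0 : 1 + d⁻¹ ≠ 0 := by
      intro h
      apply h1d0
      field_simp at h
      rw [add_comm]; simpa using h
    rcases W.2 _ hg0 with h | h
    · exact absurd (by simpa using W.1.sub_mem h W.1.one_mem) (hdiW W hW)
    · have : (1 + d)⁻¹ = 1 - (1 + d⁻¹)⁻¹ := by
        have : (1 + d⁻¹) = (1 + d) / d := by field_simp; ring
        rw [this]; field_simp; ring
      rw [this]
      exact W.1.sub_mem W.1.one_mem h
  obtain ⟨W, hW⟩ := hZ
  rcases IsLocalRing.isUnit_or_isUnit_one_sub_self (⟨(1 + d)⁻¹, he⟩ : A) with h | h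
  · obtain ⟨⟨v, hv⟩, hv'⟩ := isUnit_iff_exists_inv.1 h
    have h2 : (1 + d)⁻¹ * v = 1 := congrArg Subtype.val hv'
    have h3 : v = 1 + d := by field_simp at h2; exact h2
    exact h1d (h3 ▸ ((hA v).1 hv).1)
  · obtain ⟨⟨v, hv⟩, hv'⟩ := isUnit_iff_exists_inv.1 h
    have h2 : (1 - (1 + d)⁻¹) * v = 1 := congrArg Subtype.val hv'
    have h3 : d⁻¹ = v - 1 := by
      have h4 : (1 - (1 + d)⁻¹) = d / (1 + d) := by field_simp; ring
      rw [h4] at h2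
      field_simp at h2 ⊢
      linear_combination -h2
    exact hdiW W hW (h3 ▸ W.1.sub_mem (((hA v).1 hv).2 W hW) W.1.one_mem)

end ZarTop

end Stmt12Aux

open Stmt12Aux in
theorem stmt12 [Countable F] (A : Subring F) (hcic : IsCIC A) (hloc : IsLocalRing A)
    (hnv : ¬ IsValSubring F A) (X : Set (Zar F)) (hAX : (A : Set F) = aSet X)
    (hJ : jSet X ≠ {0}) :
    ∃ Y ⊆ limPts X, IsClosed Y ∧ aSet Y = (A : Set F) ∧
      Nonempty (Y ≃ₜ (ℕ → Bool)) := by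
  have hAX' : ∀ t, t ∈ A ↔ ∀ V ∈ X, t ∈ V.1 := by
    intro t
    rw [← mem_aSet, ← hAX]; rfl
  -- a nonzero element of `J(X)`
  have hc : ∃ c ∈ jSet X, c ≠ 0 := by
    by_contra! h
    apply hJ
    ext x
    refine ⟨fun hx => h x hx, ?_⟩
    rintro rfl
    simp only [jSet, Set.mem_iInter]
    exact fun V _ => ⟨V.1.zero_mem, Or.inl rfl⟩
  obtain ⟨c, hcJ, hc0⟩ := hc
  simp only [jSet, Set.mem_iInter] at hcJ
  have hcA : c ∈ A := (hAX' c).2 fun V hV => (hcJ V hV).1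
  have hcX : ∀ V ∈ closure X, c⁻¹ ∉ V.1 := by
    intro V hV
    exact closure_minimal (t := {V : Zar F | c⁻¹ ∉ V.1})
      (fun W hW => (hcJ W hW).2.resolve_left hc0) (isClopen_notMem _).isClosed hV
  have hAcl : ∀ t ∈ A, ∀ V ∈ closure X, t ∈ V.1 := by
    intro t ht V hV
    exact closure_minimal (t := {V : Zar F | t ∈ V.1})
      (fun W hW => (hAX' t).1 ht W hW) (isClopen_mem _).isClosed hV
  -- a minimal closed representation
  let S : Set (Set (Zar F)) := {Y | IsClosed Y ∧ Y ⊆ closure X ∧ ∀ t ∉ A, ∃ V ∈ Y, t ∉ V.1}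
  have hz : ∃ m, Minimal (· ∈ S) m := by
    apply zorn_superset
    intro C hCS hC
    rcases C.eq_empty_or_nonempty with rfl | hCne
    · refine ⟨closure X, ⟨isClosed_closure, subset_rfl, fun t ht => ?_⟩, by simp⟩
      rw [hAX'] at ht
      push Not at ht
      obtain ⟨V, hV, hV'⟩ := ht
      exact ⟨V, subset_closure hV, hV'⟩
    · refine ⟨⋂₀ C, ⟨isClosed_sInter fun Y hY => (hCS hY).1, ?_, fun t ht => ?_⟩,
        fun s hs => Set.sInter_subset_of_mem hs⟩
      · obtain ⟨Y, hY⟩ := hCne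
        exact (Set.sInter_subset_of_mem hY).trans (hCS hY).2.1
      · have : Nonempty C := hCne.to_subtype
        have hcl : ∀ Y : C, IsClosed ((Y : Set (Zar F)) ∩ {V : Zar F | t ∉ V.1}) :=
          fun Y => (hCS Y.2).1.inter (isClopen_notMem t).isClosed
        have := IsCompact.nonempty_iInter_of_directed_nonempty_isCompact_isClosed
          (fun Y : C => (Y : Set (Zar F)) ∩ {V : Zar F | t ∉ V.1})
          (by
            intro Y Y'
            rcases hC.total Y.2 Y'.2 with h | h
            · exact ⟨Y, subset_rfl, Set.inter_subset_inter_left _ h⟩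
            · exact ⟨Y', Set.inter_subset_inter_left _ h, subset_rfl⟩)
          (fun Y => (hCS Y.2).2.2 t ht) (fun Y => (hcl Y).isCompact) hcl
        obtain ⟨V, hV⟩ := this
        rw [Set.mem_iInter] at hV
        exact ⟨V, fun Y hY => (hV ⟨Y, hY⟩).1, (hV (Classical.arbitrary C)).2⟩
  obtain ⟨Y, ⟨hYcl, hYX, hYA⟩, hmin⟩ := hz
  have hYA' : ∀ t, t ∈ A ↔ ∀ V ∈ Y, t ∈ V.1 := by
    intro t
    refine ⟨fun h V hV => hAcl t h V (hYX hV), fun h => ?_⟩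
    by_contra hn
    obtain ⟨V, hV, hV'⟩ := hYA t hn
    exact hV' (h V hV)
  -- no isolated points
  have hperf : ∀ V ∈ Y, ∀ U : Set (Zar F), IsOpen U → V ∈ U → ∃ W ∈ Y, W ∈ U ∧ W ≠ V := by
    intro V hV U hU hVU
    by_contra! hiso
    have hA : ∀ t, t ∈ A ↔ t ∈ V.1 ∧ ∀ W ∈ Y \ U, t ∈ W.1 := by
      intro t
      rw [hYA']
      refine ⟨fun h => ⟨h V hV, fun W hW => h W hW.1⟩, fun h W hW => ?_⟩
      by_cases hWU : W ∈ U
      · rw [hiso W hW hWU]; exact h.1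
      · exact h.2 W ⟨hW, hWU⟩
    have hZ : (Y \ U).Nonempty := by
      by_contra hZ
      rw [Set.not_nonempty_iff_eq_empty] at hZ
      apply hnv
      intro t ht
      rw [hA, hA, hZ]
      simpa using V.2 t ht
    have hZS : Y \ U ∈ S := by
      refine ⟨hYcl.sdiff hU, Set.sdiff_subset.trans hYX, fun t ht => ?_⟩
      by_contra! hb
      exact ht (key A hcic hloc V (Y \ U) hZ hA c hc0 hcA
        (fun W hW => hcX W (hYX hW.1)) t hb)
    exact (hmin hZS Set.sdiff_subset hV).2 hVU
  have hYne : Y.Nonempty := by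
    by_contra hY
    rw [Set.not_nonempty_iff_eq_empty] at hY
    apply hnv
    intro t _
    left
    rw [hYA', hY]
    simp
  refine ⟨Y, ?_, hYcl, ?_, ?_⟩
  · intro V hV U hU hVU
    obtain ⟨W, hW, hWU, hWV⟩ := hperf V hV U hU hVU
    obtain ⟨x, hx⟩ := exists_sep hWV
    by_cases hxW : x ∈ W.1
    · obtain ⟨W', ⟨hW'U, hW'x⟩, hW'X⟩ := mem_closure_iff.1 (hYX hW) _
        (hU.inter (isOpen_mem x)) ⟨hWU, hxW⟩
      refine ⟨W', hW'X, ?_, hW'U⟩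
      rintro rfl
      exact hx ⟨fun _ => hW'x, fun _ => hxW⟩
    · obtain ⟨W', ⟨hW'U, hW'x⟩, hW'X⟩ := mem_closure_iff.1 (hYX hW) _
        (hU.inter (isOpen_notMem x)) ⟨hWU, hxW⟩
      refine ⟨W', hW'X, ?_, hW'U⟩
      rintro rfl
      exact hx ⟨fun h => absurd h hxW, fun h => absurd h hW'x⟩
  · ext t
    rw [mem_aSet, ← hYA']; rfl
  · have : CompactSpace Y := isCompact_iff_compactSpace.1 hYcl.isCompact
    have : Nonempty Y := hYne.to_subtype
    obtain ⟨e, he⟩ := exists_surjective_nat F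
    refine brouwer (fun n => {V : Y | e n ∈ V.1.1}) (fun n => ?_) ?_ ?_
    · exact (isClopen_mem (e n)).preimage continuous_subtype_val
    · intro V W hVW
      obtain ⟨x, hx⟩ := exists_sep (fun h => hVW (Subtype.ext h))
      obtain ⟨n, rfl⟩ := he x
      exact ⟨n, hx⟩
    · intro U hU V hV
      obtain ⟨U', hU', rfl⟩ := isOpen_induced_iff.1 hU
      obtain ⟨W, hW, hWU, hWV⟩ := hperf V.1 V.2 U' hU' hV
      exact ⟨⟨W, hW⟩, hWU, fun h => hWV (congrArg Subtype.val h)⟩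
end

section
/- Let X be a nonempty set of rank one valuation rings in Zar(F). Then A(X) = ⋂_{V∈X} V is a Prüfer G-domain with quotient field F if and only if J(X) = ⋂_{V∈X} 𝔪_V ≠ 0 and A(lim X) = ⋂_{U∈lim X} U is a Prüfer G-domain with quotient field F. -/
open Set

variable {F : Type*} [Field F]

/-- A valuation ring of `F` has rank one iff it is a maximal proper valuation subring of `F`. -/
def RankOne (V : Zar F) : Prop :=
  V.1 ≠ ⊤ ∧ ∀ W : Zar F, V.1 ≤ W.1 → W.1 ≠ ⊤ → W.1 = V.1

/-- A subset `A` of `F` has quotient field `F` if every element of `F` is a quotient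
of elements of `A`. -/
def HasQFSet (A : Set F) : Prop := ∀ x : F, ∃ a ∈ A, ∃ b ∈ A, b ≠ 0 ∧ x = a / b

/-- The localization of the subring `A` of `F` at the ideal `M`, realized inside `F`. -/
def locSet (A : Subring F) (M : Ideal A) : Set F :=
  {x : F | ∃ a b : A, b ∉ M ∧ (b : F) ≠ 0 ∧ x = (a : F) / (b : F)}

/-- `A` is a Prüfer domain with quotient field `F`: `F` is the quotient field of `A` and
the localization of `A` at each maximal ideal is a valuation ring of `F`. -/
def IsPruferOf (A : Subring F) : Prop :=
  HasQFSet (A : Set F) ∧ ∀ M : Ideal A, M.IsMaximal →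
    ∀ t : F, t ≠ 0 → t ∈ locSet A M ∨ t⁻¹ ∈ locSet A M

/-- `A` is a G-domain: the intersection of its nonzero prime ideals is nonzero. -/
def IsGDomainOf (A : Subring F) : Prop :=
  ∃ x : A, x ≠ 0 ∧ ∀ P : Ideal A, P.IsPrime → P ≠ ⊥ → x ∈ P

/-- `A` is a Prüfer G-domain with quotient field `F`. -/
def IsPruferG (A : Subring F) : Prop := IsPruferOf A ∧ IsGDomainOf A

section Helpers

/-- a point of `Zar F` as a bundled valuation subring -/
def toVS (V : Zar F) : ValuationSubring F :=
  { V.1 with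
    mem_or_inv_mem' := fun x => by
      by_cases hx : x = 0
      · left; rw [hx]; exact V.1.zero_mem
      · exact V.2 x hx }

/-- the associated valuation -/
noncomputable def vl (V : Zar F) : Valuation F (toVS V).ValueGroup := (toVS V).valuation

theorem mem_vl (V : Zar F) (x : F) : x ∈ V.1 ↔ vl V x ≤ 1 :=
  ((toVS V).valuation_le_one_iff x).symm

theorem vl_lt (V : Zar F) (x : F) : vl V x < 1 ↔ (x = 0 ∨ x⁻¹ ∉ V.1) := by
  by_cases hx : x = 0
  · simp [hx]
  · rw [mem_vl, map_inv₀]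
    have h0 : vl V x ≠ 0 := (Valuation.ne_zero_iff _).2 hx
    simp only [hx, false_or, not_le]
    exact (one_lt_inv₀ (zero_lt_iff.2 h0)).symm

theorem mem_mIdeal (V : Zar F) (x : F) : x ∈ mIdeal V ↔ vl V x < 1 := by
  constructor
  · intro h; exact (vl_lt V x).2 h.2
  · intro h; exact ⟨(mem_vl V x).2 h.le, (vl_lt V x).1 h⟩

theorem mem_ASub (X : Set (Zar F)) (x : F) : x ∈ ASub X ↔ ∀ V ∈ X, x ∈ V.1 := by
  simp [ASub, Subring.mem_iInf]

theorem isOpen_mem (x : F) : IsOpen {V : Zar F | x ∈ V.1} :=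
  TopologicalSpace.isOpen_generateFrom_of_mem (Or.inl ⟨x, rfl⟩)

theorem isOpen_notMem (x : F) : IsOpen {V : Zar F | x ∉ V.1} :=
  TopologicalSpace.isOpen_generateFrom_of_mem (Or.inr ⟨x, rfl⟩)

/-- compactness of the patch topology -/
theorem zar_compact : IsCompact (Set.univ : Set (Zar F)) := by
  rw [isCompact_iff_ultrafilter_le_nhds]
  intro f _
  let U : Subring F :=
    { carrier := {x | ∀ᶠ V : Zar F in f, x ∈ V.1}
      mul_mem' := fun {a b} ha hb => by
        filter_upwards [ha, hb] with V h1 h2 using V.1.mul_mem h1 h2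
      one_mem' := Filter.Eventually.of_forall fun V => V.1.one_mem
      add_mem' := fun {a b} ha hb => by
        filter_upwards [ha, hb] with V h1 h2 using V.1.add_mem h1 h2
      zero_mem' := Filter.Eventually.of_forall fun V => V.1.zero_mem
      neg_mem' := fun {a} ha => by
        filter_upwards [ha] with V h1 using V.1.neg_mem h1 }
  have hU : IsValSubring F U := by
    intro t ht
    have : ∀ᶠ V : Zar F in f, t ∈ V.1 ∨ t⁻¹ ∈ V.1 :=
      Filter.Eventually.of_forall fun V => V.2 t ht
    exact Ultrafilter.eventually_or.1 this
  let U' : Zar F := ⟨U, hU⟩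
  refine ⟨U', trivial, ?_⟩
  have hn := TopologicalSpace.nhds_generateFrom (α := Zar F)
    (g := ({S | ∃ x : F, S = {V : Zar F | x ∈ V.1}} ∪ {S | ∃ y : F, S = {V : Zar F | y ∉ V.1}}))
    (a := U')
  refine le_of_le_of_eq ?_ hn.symm
  refine le_iInf₂ fun s hs => ?_
  rw [Filter.le_principal_iff]
  obtain ⟨h1, ⟨x, rfl⟩ | ⟨x, rfl⟩⟩ := hs
  · exact h1
  · have h2 : ¬ ∀ᶠ V : Zar F in f, x ∈ V.1 := h1
    exact Ultrafilter.eventually_not.2 h2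

theorem exists_lim (X S : Set (Zar F)) (hS : S ⊆ X) (hi : S.Infinite) :
    ∃ U ∈ limPts X, ∀ O : Set (Zar F), IsOpen O → U ∈ O → ∃ W ∈ S, W ∈ O := by
  obtain ⟨U, -, hU⟩ := hi.exists_accPt_of_subset_isCompact zar_compact (Set.subset_univ S)
  rw [accPt_iff_nhds] at hU
  refine ⟨U, fun O hO hUO => ?_, fun O hO hUO => ?_⟩
  · obtain ⟨W, hW, hne⟩ := hU O (hO.mem_nhds hUO)
    exact ⟨W, hS hW.2, hne, hW.1⟩
  · obtain ⟨W, hW, hne⟩ := hU O (hO.mem_nhds hUO)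
    exact ⟨W, hW.2, hW.1⟩

theorem finite_notMem (X : Set (Zar F)) (c : F) (hc : c ∈ ASub (limPts X)) :
    {W | W ∈ X ∧ c ∉ W.1}.Finite := by
  by_contra hi
  obtain ⟨U, hU, h⟩ := exists_lim X _ (fun W hW => hW.1) hi
  obtain ⟨W, hW, hW'⟩ := h _ (isOpen_mem c) ((mem_ASub _ _).1 hc U hU)
  exact hW.2 hW'

theorem ASub_le (X : Set (Zar F)) : ASub X ≤ ASub (limPts X) := by
  intro x hx
  rw [mem_ASub] at hx ⊢
  intro U hU
  by_contra hxU
  obtain ⟨W, hW, -, h⟩ := hU _ (isOpen_notMem x) hxU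
  exact h (hx W hW)

open Filter in
theorem rank_ev (V : Zar F) (hV : RankOne V) (x t : F) (hx0 : x ≠ 0) (hx : vl V x < 1) :
    ∀ᶠ n : ℕ in atTop, vl V (x ^ n * t) < 1 := by
  have hxV : x ∈ V.1 := (mem_vl V x).2 hx.le
  have mono : ∀ {n m : ℕ} {t : F}, n ≤ m → x ^ n * t ∈ V.1 → x ^ m * t ∈ V.1 := by
    intro n m t h1 h2
    obtain ⟨k, rfl⟩ := Nat.exists_eq_add_of_le h1
    have : x ^ (n + k) * t = x ^ k * (x ^ n * t) := by ring
    rw [this]; exact V.1.mul_mem (V.1.pow_mem hxV k) h2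
  let W : Subring F :=
    { carrier := {t | ∃ n : ℕ, x ^ n * t ∈ V.1}
      mul_mem' := by
        rintro a b ⟨n, hn⟩ ⟨m, hm⟩
        refine ⟨n + m, ?_⟩
        have : x ^ (n + m) * (a * b) = (x ^ n * a) * (x ^ m * b) := by ring
        rw [this]; exact V.1.mul_mem hn hm
      one_mem' := ⟨0, by simp [V.1.one_mem]⟩
      add_mem' := by
        rintro a b ⟨n, hn⟩ ⟨m, hm⟩
        refine ⟨max n m, ?_⟩
        rw [mul_add]
        exact V.1.add_mem (mono (le_max_left _ _) hn) (mono (le_max_right _ _) hm)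
      zero_mem' := ⟨0, by simp [V.1.zero_mem]⟩
      neg_mem' := by
        rintro a ⟨n, hn⟩
        exact ⟨n, by rw [mul_neg]; exact V.1.neg_mem hn⟩ }
  have hle : V.1 ≤ W := fun y hy => ⟨0, by simpa using hy⟩
  have hW : IsValSubring F W := fun t ht => (V.2 t ht).imp (fun h => hle h) (fun h => hle h)
  have hxi : x⁻¹ ∈ W := ⟨1, by rw [pow_one, mul_inv_cancel₀ hx0]; exact V.1.one_mem⟩
  have hxn : x⁻¹ ∉ V.1 := ((vl_lt V x).1 hx).resolve_left hx0
  have htop : W = ⊤ := by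
    by_contra hne
    have := hV.2 ⟨W, hW⟩ hle hne
    exact hxn (this ▸ hxi)
  have ht : t ∈ W := by rw [htop]; trivial
  obtain ⟨n, hn⟩ := ht
  filter_upwards [eventually_ge_atTop (n + 1)] with m hm
  obtain ⟨k, rfl⟩ : ∃ k, m = k + 1 := ⟨m - 1, by omega⟩
  have h1 : vl V (x ^ k * t) ≤ 1 := (mem_vl V _).1 (mono (by omega) hn)
  have h2 : x ^ (k + 1) * t = x * (x ^ k * t) := by ring
  rw [h2, map_mul]
  exact mul_lt_one_of_lt_of_le hx h1

/-- `v` solves the local invertibility problem for `(1,t)` in `R`. -/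
def GoodV (R : Subring F) (t v : F) : Prop := v ∈ R ∧ v * t ∈ R ∧ t * (1 - v * t) ∈ R

theorem GoodV.move {R : Subring F} {t v v' : F} (h : GoodV R t v)
    (h1 : v' - v ∈ R) (h2 : (v' - v) * t ∈ R) (h3 : (v' - v) * t ^ 2 ∈ R) : GoodV R t v' := by
  refine ⟨?_, ?_, ?_⟩
  · have := R.add_mem h.1 h1
    rwa [show v + (v' - v) = v' by ring] at this
  · have := R.add_mem h.2.1 h2
    rwa [show v * t + (v' - v) * t = v' * t by ring] at this
  · have := R.sub_mem h.2.2 h3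
    rwa [show t * (1 - v * t) - (v' - v) * t ^ 2 = t * (1 - v' * t) by ring] at this

theorem good_of_prufer (B : Subring F) (hB : IsPruferOf B) (t : F) : ∃ v, GoodV B t v := by
  by_cases ht : t = 0
  · exact ⟨0, B.zero_mem, by simp [B.zero_mem], by simp [ht, B.zero_mem]⟩
  let D : F → Ideal B := fun s =>
    { carrier := {a : B | (a : F) * s ∈ B}
      add_mem' := by
        intro a b ha hb
        have := B.add_mem ha hb
        simpa [add_mul] using this
      zero_mem' := by simp [B.zero_mem]
      smul_mem' := by
        intro c a ha
        have := B.mul_mem c.2 ha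
        simpa [mul_assoc] using this }
  have hD : ∀ s a, a ∈ D s ↔ (a : F) * s ∈ B := fun s a => Iff.rfl
  have htop : D t ⊔ D t⁻¹ = ⊤ := by
    by_contra hne
    obtain ⟨M, hM, hle⟩ := Ideal.exists_le_maximal _ hne
    rcases hB.2 M hM t ht with ⟨a, b, hb, hb0, h⟩ | ⟨a, b, hb, hb0, h⟩
    · apply hb; apply hle; apply Ideal.mem_sup_left
      rw [hD, h, mul_div_cancel₀ _ hb0]; exact a.2
    · apply hb; apply hle; apply Ideal.mem_sup_right
      rw [hD, h, mul_div_cancel₀ _ hb0]; exact a.2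
  have h1 : (1 : B) ∈ D t ⊔ D t⁻¹ := by rw [htop]; trivial
  obtain ⟨u, hu, w, hw, huw⟩ := Submodule.mem_sup.1 h1
  rw [hD] at hu hw
  have huw' : (u : F) + w = 1 := by exact_mod_cast congrArg Subtype.val huw
  have hwt : (w : F) * t⁻¹ * t = w := by field_simp
  refine ⟨w * t⁻¹, hw, ?_, ?_⟩
  · rw [hwt]; exact w.2
  · rw [hwt, ← huw', add_sub_cancel_right, mul_comm]; exact hu

theorem prufer_of_good (A : Subring F) (hq : HasQFSet (A : Set F))
    (h : ∀ t, ∃ v, GoodV A t v) : IsPruferOf A := by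
  refine ⟨hq, fun M hM t ht => ?_⟩
  obtain ⟨v, h1, h2, h3⟩ := h t
  have hu : 1 - v * t ∈ A := A.sub_mem A.one_mem h2
  have nz : ∀ b : A, b ∉ M → (b : F) ≠ 0 := by
    intro b hb h0
    apply hb
    have : b = 0 := Subtype.ext h0
    rw [this]; exact M.zero_mem
  by_cases hm : (⟨v * t, h2⟩ : A) ∈ M
  · have hn : (⟨1 - v * t, hu⟩ : A) ∉ M := by
      intro hn
      apply hM.ne_top
      rw [Ideal.eq_top_iff_one]
      have := M.add_mem hm hn
      convert this
      ext; simp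
    left
    have := nz _ hn
    refine ⟨⟨_, h3⟩, ⟨_, hu⟩, hn, this, ?_⟩
    exact (mul_div_cancel_right₀ t this).symm
  · right
    have := nz _ hm
    refine ⟨⟨_, h1⟩, ⟨_, h2⟩, hm, this, ?_⟩
    have hv : v ≠ 0 := left_ne_zero_of_mul this
    change t⁻¹ = v / (v * t)
    field_simp

theorem gdom_pow (B : Subring F) (hq : HasQFSet (B : Set F)) (g : B)
    (hg : ∀ P : Ideal B, P.IsPrime → P ≠ ⊥ → g ∈ P) (t : F) : ∃ n : ℕ, (g : F) ^ n * t ∈ B := by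
  obtain ⟨a, ha, b, hb, hb0, rfl⟩ := hq t
  have : g ∈ (Ideal.span {(⟨b, hb⟩ : B)}).radical := by
    rw [Ideal.radical_eq_sInf, Ideal.mem_sInf]
    rintro P ⟨hP, hPp⟩
    apply hg P hPp
    rintro rfl
    rw [Ideal.span_singleton_le_iff_mem, Ideal.mem_bot] at hP
    exact hb0 (congrArg Subtype.val hP)
  obtain ⟨n, hn⟩ := this
  obtain ⟨c, hc⟩ := Ideal.mem_span_singleton'.1 hn
  have hc' : (c : F) * b = (g : F) ^ n := by simpa using congrArg Subtype.val hc
  refine ⟨n, ?_⟩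
  rw [← hc', show (c : F) * b * (a / b) = c * a by field_simp]
  exact B.mul_mem c.2 ha

/-- the center on `A` of a point of the Zariski-Riemann space -/
def ctr (A : Subring F) (U : Zar F) (h : A ≤ U.1) : Ideal A where
  carrier := {a | vl U (a : F) < 1}
  add_mem' := by
    intro a b ha hb
    have ha' : vl U (a : F) < 1 := ha
    have hb' : vl U (b : F) < 1 := hb
    exact Valuation.map_add_lt _ ha' hb'
  zero_mem' := by simp
  smul_mem' := by
    intro c a ha
    change vl U ((c : F) * a) < 1
    rw [map_mul, mul_comm]
    exact mul_lt_one_of_lt_of_le ha ((mem_vl U _).1 (h c.2))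

theorem ctr_prime (A : Subring F) (U : Zar F) (h : A ≤ U.1) : (ctr A U h).IsPrime := by
  refine ⟨?_, ?_⟩
  · rw [Ne, Ideal.eq_top_iff_one]
    change ¬ (vl U ((1 : A) : F) < 1)
    simp
  · intro x y hxy
    have hxy' : vl U ((x : F) * y) < 1 := hxy
    have hx : vl U (x : F) ≤ 1 := (mem_vl U _).1 (h x.2)
    have hy : vl U (y : F) ≤ 1 := (mem_vl U _).1 (h y.2)
    by_contra hc
    rw [not_or] at hc
    have hx' : ¬ vl U (x : F) < 1 := hc.1
    have hy' : ¬ vl U (y : F) < 1 := hc.2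
    rw [map_mul, le_antisymm hx (not_lt.1 hx'), le_antisymm hy (not_lt.1 hy')] at hxy'
    simp at hxy'

theorem ctr_ne_bot (A : Subring F) (hq : HasQFSet (A : Set F)) (U : Zar F) (h : A ≤ U.1)
    (hU : U.1 ≠ ⊤) : ctr A U h ≠ ⊥ := by
  intro hb
  apply hU
  rw [eq_top_iff]
  intro t _
  obtain ⟨a, ha, b, hb', hb0, rfl⟩ := hq t
  rw [div_eq_mul_inv]
  refine U.1.mul_mem (h ha) ?_
  by_contra hn
  have : (⟨b, hb'⟩ : A) ∈ ctr A U h := (vl_lt U b).2 (Or.inr hn)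
  rw [hb, Ideal.mem_bot] at this
  exact hb0 (congrArg Subtype.val this)

theorem overring (A B : Subring F) (hAB : A ≤ B) (hA : IsPruferG A) : IsPruferG B := by
  obtain ⟨⟨hq, hp⟩, x, hx0, hx⟩ := hA
  have hqB : HasQFSet (B : Set F) := by
    intro t
    obtain ⟨a, ha, b, hb, h⟩ := hq t
    exact ⟨a, hAB ha, b, hAB hb, h⟩
  refine ⟨prufer_of_good B hqB fun t => ?_, Subring.inclusion hAB x, ?_, ?_⟩
  · obtain ⟨v, h1, h2, h3⟩ := good_of_prufer A ⟨hq, hp⟩ t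
    exact ⟨v, hAB h1, hAB h2, hAB h3⟩
  · intro h
    apply hx0
    ext
    simpa using congrArg Subtype.val h
  · intro P hP hP0
    have hQ : (P.comap (Subring.inclusion hAB)).IsPrime := Ideal.comap_isPrime _ P
    refine hx (P.comap (Subring.inclusion hAB)) hQ ?_
    intro hb
    apply hP0
    rw [eq_bot_iff]
    intro p hpP
    obtain ⟨a, ha, b, hb', hb0, h⟩ := hq p
    have h2 : (⟨a, ha⟩ : A) ∈ P.comap (Subring.inclusion hAB) := by
      rw [Ideal.mem_comap]
      have := P.mul_mem_right (Subring.inclusion hAB ⟨b, hb'⟩) hpP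
      convert this
      ext
      simp only [Subring.coe_inclusion, Subring.coe_mul]
      rw [h]; field_simp
    rw [hb, Ideal.mem_bot] at h2
    have h3 : a = 0 := congrArg Subtype.val h2
    rw [Ideal.mem_bot]
    ext
    rw [h, h3]; simp

theorem fwd (X : Set (Zar F)) (h1 : ∀ V ∈ X, RankOne V) (h : IsPruferG (ASub X)) :
    jSet X ≠ {0} ∧ IsPruferG (ASub (limPts X)) := by
  refine ⟨?_, overring _ _ (ASub_le X) h⟩
  obtain ⟨⟨hq, hp⟩, x, hx0, hx⟩ := h
  intro hj
  have hxJ : (x : F) ∈ jSet X := by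
    simp only [jSet, Set.mem_iInter]
    intro V hV
    rw [mem_mIdeal]
    have hle : ASub X ≤ V.1 := fun y hy => (mem_ASub X y).1 hy V hV
    exact hx _ (ctr_prime _ V hle) (ctr_ne_bot _ hq V hle (h1 V hV).1)
  rw [hj] at hxJ
  exact hx0 (Subtype.ext hxJ)

open Filter in
theorem exists_j (X : Set (Zar F)) (h1 : ∀ V ∈ X, RankOne V) (hj : jSet X ≠ {0})
    (hB : IsPruferG (ASub (limPts X))) :
    ∃ j : F, j ≠ 0 ∧ (∀ W ∈ X, vl W j < 1) ∧ ∀ t, ∃ n : ℕ, j ^ n * t ∈ ASub (limPts X) := by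
  obtain ⟨⟨hq, -⟩, g, hg0, hg⟩ := hB
  have hg0' : (g : F) ≠ 0 := fun h => hg0 (Subtype.ext h)
  obtain ⟨i, hi, hi0⟩ : ∃ i ∈ jSet X, i ≠ 0 := by
    by_contra hc
    push Not at hc
    apply hj
    ext y
    refine ⟨fun hy => hc y hy, ?_⟩
    rintro rfl
    simp only [jSet, Set.mem_iInter]
    intro V _
    rw [mem_mIdeal]; simp
  have hiX : ∀ W ∈ X, vl W i < 1 := by
    intro W hW
    simp only [jSet, Set.mem_iInter] at hi
    exact (mem_mIdeal W i).1 (hi W hW)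
  have hiB : i ∈ ASub (limPts X) :=
    ASub_le X ((mem_ASub X i).2 fun W hW => (mem_vl W i).2 (hiX W hW).le)
  have hfin : {W | W ∈ X ∧ (g : F)⁻¹ ∈ W.1}.Finite := by
    by_contra hinf
    obtain ⟨U, hU, h⟩ := exists_lim X _ (fun W hW => hW.1) hinf
    have hle : ASub (limPts X) ≤ U.1 := fun y hy => (mem_ASub _ y).1 hy U hU
    have hUt : U.1 ≠ ⊤ := by
      intro ht
      obtain ⟨W, hW, hW'⟩ := h _ (isOpen_mem i⁻¹) (by change i⁻¹ ∈ U.1; rw [ht]; trivial)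
      exact ((vl_lt W i).1 (hiX W hW.1)).resolve_left hi0 hW'
    have hgU : vl U (g : F) < 1 := hg _ (ctr_prime _ U hle) (ctr_ne_bot _ hq U hle hUt)
    have hgU' := ((vl_lt U _).1 hgU).resolve_left hg0'
    obtain ⟨W, hW, hW'⟩ := h _ (isOpen_notMem (g : F)⁻¹) hgU'
    exact hW' hW.2
  have hev : ∀ᶠ n : ℕ in atTop, ∀ W ∈ {W | W ∈ X ∧ (g : F)⁻¹ ∈ W.1}, vl W (i ^ n * g) < 1 :=
    (eventually_all_finite hfin).2 fun W hW => rank_ev W (h1 W hW.1) i g hi0 (hiX W hW.1)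
  obtain ⟨n, hn⟩ := hev.exists
  refine ⟨i ^ n * g, mul_ne_zero (pow_ne_zero _ hi0) hg0', fun W hW => ?_, fun t => ?_⟩
  · by_cases hgW : (g : F)⁻¹ ∈ W.1
    · exact hn W ⟨hW, hgW⟩
    · have h2 : vl W (g : F) < 1 := (vl_lt W _).2 (Or.inr hgW)
      rw [map_mul, map_pow, mul_comm]
      exact mul_lt_one_of_lt_of_le h2 (pow_le_one' (hiX W hW).le n)
  · obtain ⟨m, hm⟩ := gdom_pow _ hq g hg t
    refine ⟨m, ?_⟩
    rw [mul_pow, mul_assoc]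
    exact Subring.mul_mem _ (Subring.pow_mem _ (Subring.pow_mem _ hiB n) m) hm

open Filter in
theorem pow_A (X : Set (Zar F)) (h1 : ∀ V ∈ X, RankOne V) (j : F) (hj0 : j ≠ 0)
    (hjX : ∀ W ∈ X, vl W j < 1) (hjB : ∀ t, ∃ n : ℕ, j ^ n * t ∈ ASub (limPts X)) (t : F) :
    ∀ᶠ n : ℕ in atTop, j ^ n * t ∈ ASub X := by
  obtain ⟨n, hn⟩ := hjB t
  have hfin := finite_notMem X _ hn
  have hev : ∀ᶠ m : ℕ in atTop, ∀ W ∈ {W | W ∈ X ∧ j ^ n * t ∉ W.1}, vl W (j ^ m * t) < 1 :=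
    (eventually_all_finite hfin).2 fun W hW => rank_ev W (h1 W hW.1) j t hj0 (hjX W hW.1)
  filter_upwards [hev, eventually_ge_atTop n] with m hm hnm
  rw [mem_ASub]
  intro W hW
  by_cases hc : j ^ n * t ∈ W.1
  · obtain ⟨k, rfl⟩ := Nat.exists_eq_add_of_le hnm
    rw [show j ^ (n + k) * t = j ^ k * (j ^ n * t) by ring]
    exact W.1.mul_mem (W.1.pow_mem ((mem_vl W j).2 (hjX W hW).le) k) hc
  · exact (mem_vl W _).2 (hm W ⟨hW, hc⟩).le

/-- solving the invertibility problem on a finite set -/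
theorem good_local (W : Zar F) (j t : F) (hj0 : j ≠ 0) (hj : vl W j < 1) (k : ℕ)
    (hk : t ∉ W.1 → vl W ((t⁻¹) ^ k * j⁻¹) < 1) :
    GoodV W.1 t (t ^ k * j / (1 + t ^ (k + 1) * j)) := by
  by_cases ht : t ∈ W.1
  · have htv := (mem_vl W t).1 ht
    have hjW : j ∈ W.1 := (mem_vl W j).2 hj.le
    have hs : vl W (t ^ (k + 1) * j) < 1 := by
      rw [map_mul, map_pow, mul_comm]
      exact mul_lt_one_of_lt_of_le hj (pow_le_one' htv _)
    have h1 : vl W (1 + t ^ (k + 1) * j) = 1 := Valuation.map_one_add_of_lt _ hs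
    have hinv : (1 + t ^ (k + 1) * j)⁻¹ ∈ W.1 := by
      rw [mem_vl, map_inv₀, h1, inv_one]
    have hv : t ^ k * j / (1 + t ^ (k + 1) * j) ∈ W.1 := by
      rw [div_eq_mul_inv]
      exact W.1.mul_mem (W.1.mul_mem (W.1.pow_mem ht k) hjW) hinv
    exact ⟨hv, W.1.mul_mem hv ht,
      W.1.mul_mem ht (W.1.sub_mem W.1.one_mem (W.1.mul_mem hv ht))⟩
  · have ht0 : t ≠ 0 := fun h => ht (h ▸ W.1.zero_mem)
    have hti : vl W t⁻¹ ≤ 1 := (mem_vl W _).1 ((W.2 t ht0).resolve_left ht)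
    have hk' := hk ht
    set s := t ^ (k + 1) * j with hs
    have hs0 : s ≠ 0 := mul_ne_zero (pow_ne_zero _ ht0) hj0
    have hsi : vl W s⁻¹ < 1 := by
      have : s⁻¹ = (t⁻¹ ^ k * j⁻¹) * t⁻¹ := by
        rw [hs, inv_pow]; field_simp; ring
      rw [this, map_mul]
      exact mul_lt_one_of_lt_of_le hk' hti
    have h1 : vl W (1 + s⁻¹) = 1 := Valuation.map_one_add_of_lt _ hsi
    have h10 : 1 + s⁻¹ ≠ 0 := by
      intro h; rw [h] at h1; simp at h1
    have hse : 1 + s = s * (1 + s⁻¹) := by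
      rw [mul_add, mul_inv_cancel₀ hs0]; ring
    have h1s : 1 + s ≠ 0 := by rw [hse]; exact mul_ne_zero hs0 h10
    have hinv : (1 + s⁻¹)⁻¹ ∈ W.1 := by
      rw [mem_vl, map_inv₀, h1, inv_one]
    have e1 : t ^ k * j / (1 + s) * t = (1 + s⁻¹)⁻¹ := by
      rw [hse, show t ^ k * j / (s * (1 + s⁻¹)) * t = (t ^ (k + 1) * j) / s * (1 + s⁻¹)⁻¹ by
        rw [div_eq_mul_inv, div_eq_mul_inv, mul_inv]; ring, ← hs, div_self hs0, one_mul]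
    have e0 : t ^ k * j / (1 + s) = (1 + s⁻¹)⁻¹ * t⁻¹ := by
      rw [← e1]; field_simp
    refine ⟨?_, ?_, ?_⟩
    · rw [e0]; exact W.1.mul_mem hinv ((mem_vl W _).2 hti)
    · rw [e1]; exact hinv
    · have : t * (1 - t ^ k * j / (1 + s) * t) = (t⁻¹ ^ k * j⁻¹) * (1 + s⁻¹)⁻¹ := by
        have e2 : 1 - (1 + s⁻¹)⁻¹ = s⁻¹ * (1 + s⁻¹)⁻¹ := by
          rw [eq_comm, ← sub_eq_zero]
          have : (1 + s⁻¹) * (1 + s⁻¹)⁻¹ = 1 := mul_inv_cancel₀ h10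
          linear_combination this
        rw [e1, e2, ← mul_assoc]
        congr 1
        rw [hs, inv_pow]; field_simp; ring
      rw [this]
      exact W.1.mul_mem ((mem_vl W _).2 hk'.le) hinv

open Filter in
theorem improve (X : Set (Zar F)) (h1 : ∀ V ∈ X, RankOne V) (j : F) (hj0 : j ≠ 0)
    (hjX : ∀ W ∈ X, vl W j < 1) (hjB : ∀ t, ∃ n : ℕ, j ^ n * t ∈ ASub (limPts X))
    (b : F) (hb : b ∈ ASub (limPts X)) (t v : F) :
    ∃ v', ∀ W ∈ X, (b ∉ W.1 ∨ GoodV W.1 t v) → GoodV W.1 t v' := by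
  by_cases hb0 : b = 0
  · refine ⟨v, fun W hW h => h.resolve_left ?_⟩
    rw [hb0]; exact fun h => h W.1.zero_mem
  have hfin := finite_notMem X _ hb
  have hout : ∀ (W : Zar F) (y : F), y ∉ W.1 → y⁻¹ ≠ 0 ∧ vl W y⁻¹ < 1 := by
    intro W y hy
    have hy0 : y ≠ 0 := fun h => hy (h ▸ W.1.zero_mem)
    exact ⟨inv_ne_zero hy0, (vl_lt W _).2 (Or.inr (by rwa [inv_inv]))⟩
  -- the element c = b^m j
  have hev : ∀ᶠ m : ℕ in atTop, ∀ W ∈ {W | W ∈ X ∧ b ∉ W.1}, vl W ((b⁻¹) ^ m * j⁻¹) < 1 :=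
    (eventually_all_finite hfin).2 fun W hW =>
      rank_ev W (h1 W hW.1) _ _ (hout W b hW.2).1 (hout W b hW.2).2
  obtain ⟨m, hm⟩ := hev.exists
  set c := b ^ m * j with hc
  have hc0 : c ≠ 0 := mul_ne_zero (pow_ne_zero _ hb0) hj0
  have hci : c⁻¹ = (b⁻¹) ^ m * j⁻¹ := by rw [hc, inv_pow]; field_simp
  -- local solution
  have hev2 : ∀ᶠ k : ℕ in atTop, ∀ W ∈ {W | W ∈ X ∧ b ∉ W.1},
      (t ∉ W.1 → vl W ((t⁻¹) ^ k * j⁻¹) < 1) := by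
    refine (eventually_all_finite hfin).2 fun W hW => ?_
    by_cases ht : t ∈ W.1
    · exact Eventually.of_forall fun k h => absurd ht h
    · filter_upwards [rank_ev W (h1 W hW.1) t⁻¹ j⁻¹ (hout W t ht).1 (hout W t ht).2] with k hk _
      exact hk
  obtain ⟨k, hk⟩ := hev2.exists
  obtain ⟨w, hw⟩ : ∃ w, ∀ W ∈ X, b ∉ W.1 → GoodV W.1 t w :=
    ⟨_, fun W hW hbW => good_local W j t hj0 (hjX W hW) k (hk W ⟨hW, hbW⟩)⟩
  -- the exponents
  have hA := pow_A X h1 j hj0 hjX hjB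
  obtain ⟨N, hN1, hN2, hN3⟩ :=
    ((hA (v - w)).and ((hA ((v - w) * t)).and (hA ((v - w) * t ^ 2)))).exists
  rw [mem_ASub] at hN1 hN2 hN3
  have hev3 : ∀ᶠ M : ℕ in atTop, ∀ W ∈ {W | W ∈ X ∧ b ∉ W.1},
      vl W ((c⁻¹) ^ M * (j ^ N)⁻¹) < 1 := by
    refine (eventually_all_finite hfin).2 fun W hW => ?_
    exact rank_ev W (h1 W hW.1) _ _ (inv_ne_zero hc0) (hci ▸ hm W hW)
  obtain ⟨M, hM, hMN⟩ := (hev3.and (eventually_ge_atTop (N + 1))).exists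
  have hjN0 : j ^ N ≠ 0 := pow_ne_zero _ hj0
  have key : ∀ W ∈ X, ∀ a : F, a / j ^ N ∈ W.1 → ∀ y, j ^ N * y ∈ W.1 → a * y ∈ W.1 := by
    intro W _ a ha y hy
    have := W.1.mul_mem ha hy
    rwa [show a / j ^ N * (j ^ N * y) = a * y by field_simp] at this
  set p := c ^ M with hp
  have hp0 : p ≠ 0 := pow_ne_zero _ hc0
  -- values of the separating element
  have hsep0 : ∀ W ∈ X, b ∈ W.1 → 1 + p ≠ 0 ∧ (p / (1 + p)) / j ^ N ∈ W.1 := by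
    intro W hW hbW
    have hj' := hjX W hW
    obtain ⟨L, rfl⟩ : ∃ L, M = N + (L + 1) := ⟨M - (N + 1), by omega⟩
    have e : p = j ^ N * (j * (j ^ L * (b ^ m) ^ (N + (L + 1)))) := by
      rw [hp, hc]; ring
    have hjW : j ∈ W.1 := (mem_vl W j).2 hj'.le
    have hr : j ^ L * (b ^ m) ^ (N + (L + 1)) ∈ W.1 :=
      W.1.mul_mem (W.1.pow_mem hjW _) (W.1.pow_mem (W.1.pow_mem hbW _) _)
    have hr2 : vl W (j * (j ^ L * (b ^ m) ^ (N + (L + 1)))) < 1 := by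
      rw [map_mul]
      exact mul_lt_one_of_lt_of_le hj' ((mem_vl W _).1 hr)
    have hpv : vl W p < 1 := by
      rw [e, map_mul, mul_comm]
      exact mul_lt_one_of_lt_of_le hr2 ((mem_vl W _).1 (W.1.pow_mem hjW _))
    have h1p : vl W (1 + p) = 1 := Valuation.map_one_add_of_lt _ hpv
    have h1p0 : 1 + p ≠ 0 := by
      intro h; rw [h] at h1p; simp at h1p
    refine ⟨h1p0, ?_⟩
    have : (p / (1 + p)) / j ^ N =
        (j * (j ^ L * (b ^ m) ^ (N + (L + 1)))) * (1 + p)⁻¹ := by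
      rw [div_div, div_eq_iff (mul_ne_zero h1p0 hjN0)]
      rw [show j * (j ^ L * (b ^ m) ^ (N + (L + 1))) * (1 + p)⁻¹ * ((1 + p) * j ^ N)
        = (j ^ N * (j * (j ^ L * (b ^ m) ^ (N + (L + 1))))) * ((1 + p)⁻¹ * (1 + p)) by ring,
        inv_mul_cancel₀ h1p0, mul_one]
      exact e
    rw [this]
    refine W.1.mul_mem ((mem_vl W _).2 hr2.le) ?_
    rw [mem_vl, map_inv₀, h1p, inv_one]
  have hsep1 : ∀ W ∈ X, b ∉ W.1 → 1 + p ≠ 0 ∧ (1 / (1 + p)) / j ^ N ∈ W.1 := by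
    intro W hW hbW
    have h2 := hM W ⟨hW, hbW⟩
    rw [inv_pow, ← hp] at h2
    have hjW : j ∈ W.1 := (mem_vl W j).2 (hjX W hW).le
    have hpi : vl W p⁻¹ < 1 := by
      have : p⁻¹ = (p⁻¹ * (j ^ N)⁻¹) * j ^ N := by field_simp
      rw [this, map_mul]
      exact mul_lt_one_of_lt_of_le h2 ((mem_vl W _).1 (W.1.pow_mem hjW _))
    have h1p : vl W (1 + p⁻¹) = 1 := Valuation.map_one_add_of_lt _ hpi
    have h10 : 1 + p⁻¹ ≠ 0 := by
      intro h; rw [h] at h1p; simp at h1p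
    have hse : 1 + p = p * (1 + p⁻¹) := by
      rw [mul_add, mul_inv_cancel₀ hp0]; ring
    refine ⟨by rw [hse]; exact mul_ne_zero hp0 h10, ?_⟩
    have : 1 / (1 + p) / j ^ N = (p⁻¹ * (j ^ N)⁻¹) * (1 + p⁻¹)⁻¹ := by
      rw [hse, div_div, one_div, mul_inv, mul_inv]; ring
    rw [this]
    refine W.1.mul_mem ((mem_vl W _).2 h2.le) ?_
    rw [mem_vl, map_inv₀, h1p, inv_one]
  refine ⟨p / (1 + p) * w + 1 / (1 + p) * v, fun W hW hor => ?_⟩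
  by_cases hbW : b ∈ W.1
  · obtain ⟨h10, hs⟩ := hsep0 W hW hbW
    have hg := hor.resolve_left (not_not.2 hbW)
    have e : p / (1 + p) * w + 1 / (1 + p) * v - v = -(p / (1 + p) * (v - w)) := by
      field_simp; ring
    refine hg.move ?_ ?_ ?_
    · rw [e]
      exact W.1.neg_mem (key W hW _ hs _ (hN1 W hW))
    · rw [e, neg_mul, mul_assoc]
      exact W.1.neg_mem (key W hW _ hs _ (hN2 W hW))
    · rw [e, neg_mul, mul_assoc]
      exact W.1.neg_mem (key W hW _ hs _ (hN3 W hW))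
  · obtain ⟨h10, hs⟩ := hsep1 W hW hbW
    have hg := hw W hW hbW
    have e : p / (1 + p) * w + 1 / (1 + p) * v - w = 1 / (1 + p) * (v - w) := by
      field_simp; ring
    refine hg.move ?_ ?_ ?_
    · rw [e]
      exact key W hW _ hs _ (hN1 W hW)
    · rw [e, mul_assoc]
      exact key W hW _ hs _ (hN2 W hW)
    · rw [e, mul_assoc]
      exact key W hW _ hs _ (hN3 W hW)

theorem bwd (X : Set (Zar F)) (h1 : ∀ V ∈ X, RankOne V) (hJ : jSet X ≠ {0})
    (hB : IsPruferG (ASub (limPts X))) : IsPruferG (ASub X) := by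
  obtain ⟨j, hj0, hjX, hjB⟩ := exists_j X h1 hJ hB
  have hA := fun t => (pow_A X h1 j hj0 hjX hjB t).exists
  have hjA : j ∈ ASub X := (mem_ASub X j).2 fun W hW => (mem_vl W j).2 (hjX W hW).le
  refine ⟨prufer_of_good _ ?_ ?_, ⟨j, hjA⟩, ?_, ?_⟩
  · intro x
    obtain ⟨n, hn⟩ := hA x
    exact ⟨_, hn, j ^ n, Subring.pow_mem _ hjA n, pow_ne_zero _ hj0,
      (mul_div_cancel_left₀ x (pow_ne_zero n hj0)).symm⟩
  · intro t
    obtain ⟨v0, hv1, hv2, hv3⟩ := good_of_prufer _ hB.1 t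
    let E : Set (Zar F) := {W | W ∈ X ∧ ¬ GoodV W.1 t v0}
    have hE : E.Finite := by
      refine ((finite_notMem X _ hv1).union
        ((finite_notMem X _ hv2).union (finite_notMem X _ hv3))).subset ?_
      rintro W ⟨hW, hn⟩
      by_contra hc
      simp only [Set.mem_union, Set.mem_ofPred_eq, hW, true_and, not_or, not_not] at hc
      exact hn ⟨hc.1, hc.2.1, hc.2.2⟩
    have hEb : ∀ V ∈ E, ∃ b ∈ ASub (limPts X), b ∉ V.1 := by
      rintro V ⟨hV, hn⟩
      by_contra hc
      push Not at hc
      exact hn ⟨hc _ hv1, hc _ hv2, hc _ hv3⟩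
    have hind : ∀ S : Set (Zar F), S.Finite → S ⊆ E →
        ∃ v, ∀ W ∈ X, (W ∉ E ∨ W ∈ S) → GoodV W.1 t v := by
      intro S hS
      induction S, hS using Set.Finite.induction_on with
      | empty =>
        intro _
        refine ⟨v0, fun W hW h => ?_⟩
        rcases h with h | h
        · by_contra hn; exact h ⟨hW, hn⟩
        · exact absurd h (Set.notMem_empty _)
      | @insert V S _ _ ih =>
        intro hVS
        obtain ⟨v, hv⟩ := ih fun W hW => hVS (Set.mem_insert_of_mem _ hW)
        obtain ⟨b, hb, hbV⟩ := hEb V (hVS (Set.mem_insert _ _))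
        obtain ⟨v', hv'⟩ := improve X h1 j hj0 hjX hjB b hb t v
        refine ⟨v', fun W hW h => hv' W hW ?_⟩
        rcases h with h | h
        · exact Or.inr (hv W hW (Or.inl h))
        · rcases h with rfl | h
          · exact Or.inl hbV
          · exact Or.inr (hv W hW (Or.inr h))
    obtain ⟨v, hv⟩ := hind E hE subset_rfl
    have hv' : ∀ W ∈ X, GoodV W.1 t v := fun W hW => hv W hW (em _).symm
    exact ⟨v, (mem_ASub _ _).2 fun W hW => (hv' W hW).1,
      (mem_ASub _ _).2 fun W hW => (hv' W hW).2.1,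
      (mem_ASub _ _).2 fun W hW => (hv' W hW).2.2⟩
  · intro h; exact hj0 (congrArg Subtype.val h)
  · intro P hP hP0
    obtain ⟨p, hp, hp0⟩ := Submodule.exists_mem_ne_zero_of_ne_bot hP0
    have hp0' : (p : F) ≠ 0 := fun h => hp0 (Subtype.ext h)
    obtain ⟨n, hn⟩ := hA (p : F)⁻¹
    apply hP.mem_of_pow_mem n
    have := P.mul_mem_left ⟨_, hn⟩ hp
    convert this
    ext
    simp [hp0']

end Helpers

theorem stmt15 (X : Set (Zar F)) (hX : X.Nonempty) (h1 : ∀ V ∈ X, RankOne V) :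
    IsPruferG (ASub X) ↔ (jSet X ≠ {0} ∧ IsPruferG (ASub (limPts X))) := by
  exact ⟨fwd X h1, fun h => bwd X h1 h.1 h.2⟩
end
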